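/- arXiv:2406.18735 — 7 statements merged into one kernel-verified Lean document; each statement's English description precedes it below -/
import Mathlib

section
/- Let K : ℝ → ℝ be continuous and suppose there exists a solution J⁺ of the Jacobi equation J''(t) + K(t)·J(t) = 0 with J⁺(t) ≠ 0 for every t ∈ ℝ. Then K is without conjugate points, i.e., every solution J with J(a) = 0 and J(b) = 0 for some a ≠ b is identically zero. -/
open Set MeasureTheory Filter

/-- A solution of the scalar Jacobi equation `J'' + K·J = 0`. -/
def IsJacobiSolution (K J : ℝ → ℝ) : Prop :=
  ContDiff ℝ 2 J ∧ ∀ t : ℝ, deriv (deriv J) t + K t * J t = 0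

/-- `K` is without conjugate points: any solution vanishing at two distinct
points vanishes identically. -/
def WithoutConjugatePoints (K : ℝ → ℝ) : Prop :=
  ∀ J : ℝ → ℝ, IsJacobiSolution K J →
    ∀ a b : ℝ, a ≠ b → J a = 0 → J b = 0 → ∀ t : ℝ, J t = 0

/-- The Wronskian of two solutions of the same Jacobi equation is constant. -/
theorem IsJacobiSolution.wronskian_eq {K J P : ℝ → ℝ} (hJ : IsJacobiSolution K J)
    (hP : IsJacobiSolution K P) (s t : ℝ) :
    deriv J s * P s - J s * deriv P s = deriv J t * P t - J t * deriv P t := by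
  have hderiv : ∀ {F : ℝ → ℝ}, IsJacobiSolution K F → ∀ x,
      HasDerivAt F (deriv F x) x ∧ HasDerivAt (deriv F) (-(K x * F x)) x := by
    intro F hF x
    refine ⟨(hF.1.differentiable (by norm_num) x).hasDerivAt, ?_⟩
    have h := ((hF.1.deriv' (n := 1)).differentiable (by norm_num) x).hasDerivAt
    rwa [eq_neg_of_add_eq_zero_left (hF.2 x)] at h
  have hW : ∀ x, HasDerivAt (fun y => deriv J y * P y - J y * deriv P y) 0 x := by
    intro x
    obtain ⟨hJ1, hJ2⟩ := hderiv hJ x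
    obtain ⟨hP1, hP2⟩ := hderiv hP x
    exact ((hJ2.mul hP1).sub (hJ1.mul hP2)).congr_deriv (by ring)
  exact is_const_of_deriv_eq_zero (fun x => (hW x).differentiableAt) (fun x => (hW x).deriv) s t

theorem stmt_2 (K : ℝ → ℝ) (hK : Continuous K)
    (Jplus : ℝ → ℝ) (hJplus : IsJacobiSolution K Jplus)
    (hne : ∀ t : ℝ, Jplus t ≠ 0) :
    WithoutConjugatePoints K := by
  intro J hJ a b hab ha hb t
  have hQ : ∀ x, HasDerivAt (fun y => J y / Jplus y)
      ((deriv J x * Jplus x - J x * deriv Jplus x) / Jplus x ^ 2) x := fun x =>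
    (hJ.1.differentiable (by norm_num) x).hasDerivAt.div
      (hJplus.1.differentiable (by norm_num) x).hasDerivAt (hne x)
  obtain ⟨c, hc⟩ : ∃ c, deriv J c * Jplus c - J c * deriv Jplus c = 0 := by
    wlog hlt : a < b generalizing a b
    · exact this b a hab.symm hb ha (lt_of_le_of_ne (not_lt.mp hlt) hab.symm)
    obtain ⟨c, -, hc⟩ := exists_hasDerivAt_eq_zero hlt
      (fun x _ => (hQ x).continuousAt.continuousWithinAt) (by simp [ha, hb]) (fun x _ => hQ x)
    exact ⟨c, (div_eq_zero_iff.mp hc).resolve_right (pow_ne_zero 2 (hne c))⟩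
  have hconst : J t / Jplus t = J a / Jplus a :=
    is_const_of_deriv_eq_zero (fun x => (hQ x).differentiableAt)
      (fun x => by rw [(hQ x).deriv, hJ.wronskian_eq hJplus x c, hc, zero_div]) t a
  rw [ha, zero_div] at hconst
  exact (div_eq_zero_iff.mp hconst).resolve_right (hne t)
end

section
/- Let K : ℝ → ℝ be continuous and without conjugate points, let J^z be the solution of the Jacobi equation with J^z(0) = 0 and (J^z)'(0) = 1, and for r > 0 let J^r be the unique solution with J^r(0) = 1 and J^r(r) = 0. Then for all 0 < s < r, one has (J^r)'(0) − (J^s)'(0) = ∫ₛʳ (J^z(u))⁻² du > 0; in particular the function r ↦ (J^r)'(0) is strictly increasing on (0, ∞). -/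
open Set MeasureTheory Filter

/-- A Jacobi solution has its derivative as pointwise derivative. -/
theorem IsJacobiSolution.hasDerivAt {K J : ℝ → ℝ} (hJ : IsJacobiSolution K J) (t : ℝ) :
    HasDerivAt J (deriv J t) t :=
  (hJ.1.differentiable (by norm_num) t).hasDerivAt

theorem IsJacobiSolution.hasDerivAt_deriv {K J : ℝ → ℝ} (hJ : IsJacobiSolution K J) (t : ℝ) :
    HasDerivAt (deriv J) (-(K t * J t)) t := by
  have h : Differentiable ℝ (deriv J) :=
    ContDiff.differentiable (n := 1) (ContDiff.deriv' (by norm_num; exact hJ.1)) (by norm_num)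
  rw [← eq_neg_of_add_eq_zero_left (hJ.2 t)]
  exact (h t).hasDerivAt

/-- The Wronskian of two Jacobi solutions is constant. -/
theorem IsJacobiSolution.wronskian_eq_s6 {K J₁ J₂ : ℝ → ℝ} (h₁ : IsJacobiSolution K J₁)
    (h₂ : IsJacobiSolution K J₂) (a b : ℝ) :
    deriv J₁ a * J₂ a - J₁ a * deriv J₂ a = deriv J₁ b * J₂ b - J₁ b * deriv J₂ b := by
  have h : ∀ t, HasDerivAt (fun t => deriv J₁ t * J₂ t - J₁ t * deriv J₂ t) 0 t := fun t =>
    (((h₁.hasDerivAt_deriv t).mul (h₂.hasDerivAt t)).sub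
      ((h₁.hasDerivAt t).mul (h₂.hasDerivAt_deriv t))).congr_deriv (by ring)
  exact is_const_of_deriv_eq_zero (fun t => (h t).differentiableAt) (fun t => (h t).deriv) a b

/-- Without conjugate points, a solution vanishing at `0` with nonzero derivative there
vanishes nowhere else. -/
theorem WithoutConjugatePoints.ne_zero {K J : ℝ → ℝ} (hK : WithoutConjugatePoints K)
    (hJ : IsJacobiSolution K J) (h0 : J 0 = 0) (h0' : deriv J 0 ≠ 0) {u : ℝ} (hu : u ≠ 0) :
    J u ≠ 0 := fun h => h0' <| by
  rw [funext (hK J hJ u 0 hu h h0), deriv_const]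

theorem stmt_6 (K : ℝ → ℝ) (hK : Continuous K)
    (hwcp : WithoutConjugatePoints K)
    (Jz : ℝ → ℝ) (hJz : IsJacobiSolution K Jz) (hJz0 : Jz 0 = 0)
    (hJz0' : deriv Jz 0 = 1)
    (s r : ℝ) (hs : 0 < s) (hsr : s < r)
    (Js : ℝ → ℝ) (hJs : IsJacobiSolution K Js) (hJs0 : Js 0 = 1)
    (hJss : Js s = 0)
    (Jr : ℝ → ℝ) (hJr : IsJacobiSolution K Jr) (hJr0 : Jr 0 = 1)
    (hJrr : Jr r = 0) :
    deriv Jr 0 - deriv Js 0 = ∫ u in s..r, (Jz u ^ 2)⁻¹ ∧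
      deriv Js 0 < deriv Jr 0 := by
  have hne : ∀ u ∈ Icc s r, Jz u ≠ 0 := fun u hu =>
    hwcp.ne_zero hJz hJz0 (by simp [hJz0']) (hs.trans_le hu.1).ne'
  have hcont : ContinuousOn (fun u => (Jz u ^ 2)⁻¹) (Icc s r) :=
    (hJz.1.continuous.pow 2).continuousOn.inv₀ fun u hu => pow_ne_zero 2 (hne u hu)
  have hint : IntervalIntegrable (fun u => (Jz u ^ 2)⁻¹) volume s r :=
    hcont.intervalIntegrable_of_Icc hsr.le
  have hquot : ∀ u ∈ uIcc s r, HasDerivAt (fun u => -(Js u / Jz u)) (Jz u ^ 2)⁻¹ u := by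
    intro u hu
    have hu' := hne u (uIcc_of_le hsr.le ▸ hu)
    refine ((hJs.hasDerivAt u).div (hJz.hasDerivAt u) hu').neg.congr_deriv ?_
    rw [hJs.wronskian_eq_s6 hJz u 0, hJz0, hJs0, hJz0']
    field_simp
    norm_num
  have hval := intervalIntegral.integral_eq_sub_of_hasDerivAt hquot hint
  have hrs := hJr.wronskian_eq_s6 hJs 0 r
  have hrz := hJr.wronskian_eq_s6 hJz 0 r
  rw [hJr0, hJs0, hJrr] at hrs
  rw [hJr0, hJz0, hJz0', hJrr] at hrz
  have hr := hne r (right_mem_Icc.2 hsr.le)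
  have heq : deriv Jr 0 - deriv Js 0 = ∫ u in s..r, (Jz u ^ 2)⁻¹ := by
    rw [hval, hJss]
    field_simp
    linear_combination Jz r * hrs - Js r * hrz
  have hpos : 0 < ∫ u in s..r, (Jz u ^ 2)⁻¹ :=
    intervalIntegral.intervalIntegral_pos_of_pos_on hint
      (fun u hu => inv_pos.2 (sq_pos_of_ne_zero (hne u (Ioo_subset_Icc_self hu)))) hsr
  exact ⟨heq, by linarith⟩
end

section
/- Let K : ℝ → ℝ be continuous and without conjugate points, and for r > 0 let J^r be the unique solution of the Jacobi equation with J^r(0) = 1 and J^r(r) = 0. Then the limit lim_{r→+∞} (J^r)'(0) exists; that is, there is a real number L such that (J^r)'(0) tends to L as r tends to +∞. -/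
open Set MeasureTheory Filter

/-- Linear combinations of Jacobi solutions are Jacobi solutions. -/
theorem IsJacobiSolution.linear_combination {K f g : ℝ → ℝ} (hf : IsJacobiSolution K f)
    (hg : IsJacobiSolution K g) (a b : ℝ) :
    IsJacobiSolution K (fun t => a * f t + b * g t) := by
  have df : Differentiable ℝ f := hf.1.differentiable (by norm_num)
  have dg : Differentiable ℝ g := hg.1.differentiable (by norm_num)
  have df' : Differentiable ℝ (deriv f) :=
    (hf.1.iterate_deriv' 1 1).differentiable (by norm_num)
  have dg' : Differentiable ℝ (deriv g) :=
    (hg.1.iterate_deriv' 1 1).differentiable (by norm_num)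
  have h1 : deriv (fun t => a * f t + b * g t) = fun t => a * deriv f t + b * deriv g t :=
    funext fun t =>
      (((df t).hasDerivAt.const_mul a).add ((dg t).hasDerivAt.const_mul b)).deriv
  refine ⟨(contDiff_const.mul hf.1).add (contDiff_const.mul hg.1), fun t => ?_⟩
  have h2 : deriv (fun t => a * deriv f t + b * deriv g t) t
      = a * deriv (deriv f) t + b * deriv (deriv g) t :=
    (((df' t).hasDerivAt.const_mul a).add ((dg' t).hasDerivAt.const_mul b)).deriv
  rw [h1, h2]
  linear_combination a * hf.2 t + b * hg.2 t

theorem IsJacobiSolution.differentiable {K f : ℝ → ℝ} (hf : IsJacobiSolution K f) :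
    Differentiable ℝ f :=
  hf.1.differentiable (by norm_num)

theorem IsJacobiSolution.sub {K f g : ℝ → ℝ} (hf : IsJacobiSolution K f)
    (hg : IsJacobiSolution K g) : IsJacobiSolution K (fun t => f t - g t) := by
  simpa [sub_eq_add_neg] using hf.linear_combination hg 1 (-1)

/-- A continuous real function without zeros on an interval has constant sign there. -/
theorem Set.OrdConnected.pos_of_forall_ne_zero {f : ℝ → ℝ} {s : Set ℝ} (hs : s.OrdConnected)
    (hf : Continuous f) (hne : ∀ t ∈ s, f t ≠ 0) {x y : ℝ} (hx : x ∈ s) (hy : y ∈ s)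
    (hpos : 0 < f x) : 0 < f y := by
  by_contra! hle
  obtain ⟨t, ht, ht0⟩ := intermediate_value_uIcc (hf.continuousOn (s := uIcc y x))
    (mem_uIcc.2 (Or.inl ⟨hle, hpos.le⟩))
  exact hne t (hs.uIcc_subset hy hx ht) ht0

/-- Without conjugate points, a Jacobi solution vanishing at `a` and positive at some `b > a` is
positive on all of `(a, ∞)`. -/
theorem WithoutConjugatePoints.pos_of_lt {K f : ℝ → ℝ} (hK : WithoutConjugatePoints K)
    (hf : IsJacobiSolution K f) {a b : ℝ} (ha : f a = 0) (hab : a < b) (hb : 0 < f b)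
    {t : ℝ} (ht : a < t) : 0 < f t :=
  ordConnected_Ioi.pos_of_forall_ne_zero hf.1.continuous
    (fun u (hu : a < u) hu0 => hb.ne' (hK f hf a u hu.ne ha hu0 b)) hab ht hb

/-- Without conjugate points, a Jacobi solution vanishing at `a` and positive at some `b < a` is
positive on all of `(-∞, a)`. -/
theorem WithoutConjugatePoints.pos_of_gt {K f : ℝ → ℝ} (hK : WithoutConjugatePoints K)
    (hf : IsJacobiSolution K f) {a b : ℝ} (ha : f a = 0) (hab : b < a) (hb : 0 < f b)
    {t : ℝ} (ht : t < a) : 0 < f t :=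
  ordConnected_Iio.pos_of_forall_ne_zero hf.1.continuous
    (fun u (hu : u < a) hu0 => hb.ne' (hK f hf a u hu.ne' ha hu0 b)) hab ht hb

/-- A function vanishing at `a` and positive to the right of `a` has nonnegative derivative. -/
theorem deriv_nonneg_of_pos_right {f : ℝ → ℝ} {a : ℝ} (hf : DifferentiableAt ℝ f a)
    (ha : f a = 0) (hpos : ∀ t, a < t → 0 < f t) : 0 ≤ deriv f a := by
  refine ge_of_tendsto (x := nhdsWithin a (Ioi a)) (hasDerivAt_iff_tendsto_slope.1 hf.hasDerivAt |>.mono_left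
    (nhdsWithin_mono a fun t (ht : a < t) => ht.ne')) ?_
  filter_upwards [self_mem_nhdsWithin] with t ht
  rw [slope_def_field, ha, sub_zero]
  exact div_nonneg (hpos t ht).le (sub_nonneg.2 (le_of_lt ht))

theorem stmt_8 (K : ℝ → ℝ) (hK : Continuous K)
    (hwcp : WithoutConjugatePoints K)
    (J : ℝ → ℝ → ℝ)
    (hJ : ∀ r : ℝ, 0 < r →
      IsJacobiSolution K (J r) ∧ J r 0 = 1 ∧ J r r = 0) :
    ∃ L : ℝ, Tendsto (fun r => deriv (J r) 0) atTop (nhds L) := by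
  have hpos : ∀ s, 0 < s → ∀ t, t < s → 0 < J s t := fun s hs t ht =>
    hwcp.pos_of_gt (hJ s hs).1 (hJ s hs).2.2 hs (by simp [(hJ s hs).2.1]) ht
  have hsub_zero : ∀ r s, 0 < r → 0 < s → J s 0 - J r 0 = 0 := fun r s hr hs => by
    rw [(hJ r hr).2.1, (hJ s hs).2.1, sub_self]
  have hsub_pos : ∀ r s, 0 < r → r < s → ∀ t, 0 < t → 0 < J s t - J r t :=
    fun r s hr hrs t ht =>
      hwcp.pos_of_lt ((hJ s (hr.trans hrs)).1.sub (hJ r hr).1)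
        (hsub_zero r s hr (hr.trans hrs)) hr
        (by simpa [(hJ r hr).2.2] using hpos s (hr.trans hrs) r hrs) ht
  have hderiv : ∀ r s, 0 < r → 0 < s →
      deriv (fun t => J s t - J r t) 0 = deriv (J s) 0 - deriv (J r) 0 := fun r s hr hs =>
    deriv_fun_sub ((hJ s hs).1.differentiable 0) ((hJ r hr).1.differentiable 0)
  have hmono : ∀ r s, 0 < r → r ≤ s → deriv (J r) 0 ≤ deriv (J s) 0 := fun r s hr hrs => by
    rcases hrs.eq_or_lt with rfl | hlt
    · rfl
    have hs := hr.trans hlt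
    rw [← sub_nonneg, ← hderiv r s hr hs]
    exact deriv_nonneg_of_pos_right (((hJ s hs).1.sub (hJ r hr).1).differentiable 0)
      (hsub_zero r s hr hs) (hsub_pos r s hr hlt)
  set Y : ℝ → ℝ := fun t => J 2 t - J 1 t with hY
  have hYsol : IsJacobiSolution K Y := (hJ 2 two_pos).1.sub (hJ 1 one_pos).1
  have hY0 : Y 0 = 0 := hsub_zero 1 2 one_pos two_pos
  have hYpos : ∀ t, 0 < t → 0 < Y t := hsub_pos 1 2 one_pos one_lt_two
  have hYderiv : 0 ≤ deriv Y 0 :=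
    deriv_nonneg_of_pos_right (hYsol.differentiable 0) hY0 hYpos
  have hrep : ∀ s, 1 < s → ∃ c, (∀ t, J s t - J 1 t = c * Y t) ∧
      deriv (J s) 0 = deriv (J 1) 0 + c * deriv Y 0 := fun s hs => by
    have hs0 : 0 < s := one_pos.trans hs
    have hY1 := (hYpos 1 one_pos).ne'
    have hD := (hJ s hs0).1.sub (hJ 1 one_pos).1
    have hc : ∀ t, J s t - J 1 t = (J s 1 - J 1 1) / Y 1 * Y t := fun t => by
      have h0 := hwcp _ (hD.linear_combination hYsol 1 (-((J s 1 - J 1 1) / Y 1))) 0 1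
        zero_ne_one (by simp only [hsub_zero 1 s one_pos hs0, hY0]; ring)
        (by field_simp; ring) t
      linear_combination h0
    refine ⟨_, hc, ?_⟩
    have h1 := hderiv 1 s one_pos hs0
    rw [funext hc, deriv_const_mul _ (hYsol.differentiable 0)] at h1
    linear_combination -h1
  obtain ⟨B, hB⟩ : ∃ B, ∀ s, 1 < s → deriv (J s) 0 ≤ B := by
    by_cases hneg : ∃ t < 0, Y t < 0
    · obtain ⟨t, ht, hYt⟩ := hneg
      refine ⟨deriv (J 1) 0 + J 1 t / (-Y t) * deriv Y 0, fun s hs => ?_⟩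
      obtain ⟨c, hc, hcd⟩ := hrep s hs
      have hle : c ≤ J 1 t / (-Y t) := by
        rw [le_div_iff₀ (neg_pos.2 hYt)]
        linarith [hc t, hpos s (one_pos.trans hs) t (by linarith)]
      rw [hcd]
      gcongr
    · push Not at hneg
      have hmin : IsLocalMin Y 0 := Eventually.of_forall fun t => by
        rw [hY0]
        rcases lt_trichotomy t 0 with h | rfl | h
        exacts [hneg t h, hY0.ge, (hYpos t h).le]
      refine ⟨deriv (J 1) 0, fun s hs => ?_⟩
      obtain ⟨c, -, hcd⟩ := hrep s hs
      rw [hcd, hmin.deriv_eq_zero, mul_zero, add_zero]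
  have hgmono : Monotone fun r => deriv (J (max r 2)) 0 := fun r s hrs =>
    hmono _ _ (two_pos.trans_le (le_max_right _ _)) (max_le_max_right 2 hrs)
  have hgbdd : BddAbove (range fun r => deriv (J (max r 2)) 0) :=
    ⟨B, by rintro _ ⟨r, rfl⟩; exact hB _ (one_lt_two.trans_le (le_max_right _ _))⟩
  refine ⟨_, (tendsto_atTop_ciSup hgmono hgbdd).congr' ?_⟩
  filter_upwards [eventually_ge_atTop 2] with r hr
  rw [max_eq_left hr]
end

section
/- Let K : ℝ → ℝ be continuous and let k > 0 satisfy K(t) > −k² for all t ∈ ℝ. If u : (0, ∞) → ℝ is differentiable and satisfies the Riccati equation u'(t) + u(t)² + K(t) = 0 for all t > 0, then −k ≤ u(t) ≤ k·coth(k·t) for all t > 0. -/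
open Set MeasureTheory Filter

/-- Comparison of a solution of the Riccati inequality `u' + u² ≤ k²` on `(0, ∞)` with the
solutions `k·coth(k(t - a))` of the Riccati equation of constant curvature `-k²`. -/
theorem mul_sinh_le_mul_cosh_of_riccati {k : ℝ} (hk : 0 < k) {u : ℝ → ℝ}
    (hu : ∀ t : ℝ, 0 < t → DifferentiableAt ℝ u t)
    (hric : ∀ t : ℝ, 0 < t → deriv u t + u t ^ 2 ≤ k ^ 2) {a t : ℝ} (ha : 0 < a) (ht : 0 < t) :
    u t * Real.sinh (k * (t - a)) ≤ k * Real.cosh (k * (t - a)) := by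
  have hcont : ContinuousOn u (Ioi 0) := fun s hs => (hu s hs).continuousAt.continuousWithinAt
  have hU : ∀ s : ℝ, 0 < s → HasDerivAt (fun x => ∫ y in a..x, u y) (u s) s := by
    intro s hs
    refine intervalIntegral.integral_hasDerivAt_right ?_
      (hcont.stronglyMeasurableAtFilter isOpen_Ioi s hs) (hu s hs).continuousAt
    refine (hcont.mono fun x hx => ?_).intervalIntegrable
    exact lt_of_lt_of_le (lt_min ha hs) hx.1
  set φ : ℝ → ℝ := fun s => (u s * Real.sinh (k * (s - a)) - k * Real.cosh (k * (s - a))) *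
    Real.exp (∫ y in a..s, u y) with hφ
  have hder : ∀ s : ℝ, 0 < s → HasDerivAt φ
      ((deriv u s + u s ^ 2 - k ^ 2) * Real.sinh (k * (s - a)) *
        Real.exp (∫ y in a..s, u y)) s := by
    intro s hs
    have hl : HasDerivAt (fun x => k * (x - a)) k s := by
      simpa using ((hasDerivAt_id s).sub_const a).const_mul k
    refine ((((hu s hs).hasDerivAt.mul hl.sinh).sub (hl.cosh.const_mul k)).mul
      (hU s hs).exp).congr_deriv ?_
    simp only [Pi.sub_apply, Pi.mul_apply]
    ring
  have hφa : φ a ≤ 0 := by simp [hφ, hk.le]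
  suffices h : φ t ≤ 0 by
    have := nonpos_of_mul_nonpos_left h (Real.exp_pos _)
    linarith
  rcases le_total a t with hat | hta
  · have hanti : AntitoneOn φ (Ici a) := by
      refine antitoneOn_of_deriv_nonpos (convex_Ici a)
        (fun s hs => (hder s (ha.trans_le hs)).continuousAt.continuousWithinAt) ?_ ?_
      · rw [interior_Ici]
        exact fun s hs => (hder s (ha.trans hs)).differentiableAt.differentiableWithinAt
      · rw [interior_Ici]
        intro s hs
        have hs0 : 0 < s := ha.trans hs
        rw [(hder s hs0).deriv]
        refine mul_nonpos_of_nonpos_of_nonneg (mul_nonpos_of_nonpos_of_nonneg ?_ ?_)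
          (Real.exp_pos _).le
        · linarith [hric s hs0]
        · exact Real.sinh_nonneg_iff.2 (mul_nonneg hk.le (sub_nonneg.2 (le_of_lt hs)))
    exact (hanti self_mem_Ici hat hat).trans hφa
  · have hmono : MonotoneOn φ (Ioc 0 a) := by
      refine monotoneOn_of_deriv_nonneg (convex_Ioc 0 a)
        (fun s hs => (hder s hs.1).continuousAt.continuousWithinAt) ?_ ?_
      · rw [interior_Ioc]
        exact fun s hs => (hder s hs.1).differentiableAt.differentiableWithinAt
      · rw [interior_Ioc]
        intro s hs
        rw [(hder s hs.1).deriv]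
        refine mul_nonneg (mul_nonneg_of_nonpos_of_nonpos ?_ ?_) (Real.exp_pos _).le
        · linarith [hric s hs.1]
        · exact Real.sinh_nonpos_iff.2
            (mul_nonpos_of_nonneg_of_nonpos hk.le (sub_nonpos.2 hs.2.le))
    exact (hmono ⟨ht, hta⟩ ⟨ha, le_rfl⟩ hta).trans hφa

theorem stmt_11 (K : ℝ → ℝ) (hK : Continuous K) (k : ℝ) (hk : 0 < k)
    (hKk : ∀ t : ℝ, -k ^ 2 < K t)
    (u : ℝ → ℝ) (hu : ∀ t : ℝ, 0 < t → DifferentiableAt ℝ u t)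
    (hric : ∀ t : ℝ, 0 < t → deriv u t + u t ^ 2 + K t = 0) :
    ∀ t : ℝ, 0 < t →
      -k ≤ u t ∧ u t ≤ k * (Real.cosh (k * t) / Real.sinh (k * t)) := by
  intro t ht
  have hcomp : ∀ a : ℝ, 0 < a →
      u t * Real.sinh (k * (t - a)) ≤ k * Real.cosh (k * (t - a)) := fun a ha =>
    mul_sinh_le_mul_cosh_of_riccati hk hu
      (fun s hs => by linarith [hric s hs, hKk s]) ha ht
  constructor
  · by_contra! hlt
    have hδ : 0 < -k - u t := by linarith
    obtain ⟨x, hx, hxδ⟩ : ∃ x : ℝ, 0 < x ∧ k - u t < x * (-k - u t) :=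
      ⟨(k - u t) / (-k - u t) + 1, by have : 0 < k - u t := by linarith
                                      positivity,
        by rw [add_mul, div_mul_cancel₀ _ hδ.ne']; linarith⟩
    have h := hcomp (t + x / k) (by positivity)
    have harg : k * (t - (t + x / k)) = -x := by field_simp; ring
    rw [harg, Real.sinh_neg, Real.cosh_neg, Real.sinh_eq, Real.cosh_eq] at h
    have hexp : x < Real.exp x := by linarith [Real.add_one_le_exp x]
    have hneg : Real.exp (-x) ≤ 1 := Real.exp_le_one_iff.2 (by linarith)
    have h₁ := mul_lt_mul_of_pos_right hexp hδ
    have h₂ := mul_le_mul_of_nonneg_right hneg (show 0 ≤ k - u t by linarith)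
    linarith
  · rw [← mul_div_assoc, le_div_iff₀ (Real.sinh_pos_iff.2 (mul_pos hk ht))]
    have hclosed : IsClosed
        {a : ℝ | u t * Real.sinh (k * (t - a)) ≤ k * Real.cosh (k * (t - a))} :=
      isClosed_le (by fun_prop) (by fun_prop)
    have hmem : u t * Real.sinh (k * (t - 0)) ≤ k * Real.cosh (k * (t - 0)) :=
      closure_minimal (s := Ioi (0 : ℝ)) (fun a ha => hcomp a ha) hclosed
        (closure_Ioi (0 : ℝ) ▸ self_mem_Ici)
    simpa using hmem
end

section
/- Let K : ℝ → ℝ be continuous and let k > 0 satisfy K(t) > −k² for all t ∈ ℝ. If u : ℝ → ℝ is differentiable and satisfies the Riccati equation u'(t) + u(t)² + K(t) = 0 for all t ∈ ℝ, then |u(t)| ≤ k for all t ∈ ℝ. -/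
open Set MeasureTheory Filter

/-- A global solution of the differential inequality `u' < k² - u²` is bounded below by `-k`:
below `-k` it would blow up in finite forward time. -/
theorem neg_le_of_deriv_lt_sq_sub_sq {k : ℝ} (hk : 0 < k) {u : ℝ → ℝ} (hu : Differentiable ℝ u)
    (h : ∀ t, deriv u t < k ^ 2 - u t ^ 2) (a : ℝ) : -k ≤ u a := by
  by_contra! ha
  have hle : ∀ t, a ≤ t → u t ≤ u a := by
    intro t hat
    refine image_le_of_deriv_right_lt_deriv_boundary (f := u) (f' := deriv u) (a := a) (b := t)
      (B := fun _ => u a) (B' := fun _ => 0) hu.continuous.continuousOn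
      (fun x _ => (hu x).hasDerivAt.hasDerivWithinAt) le_rfl
      (fun x => hasDerivAt_const x (u a)) (fun x _ hx => ?_) ⟨hat, le_rfl⟩
    have := h x
    rw [hx] at this
    nlinarith
  have hneg : ∀ t, a ≤ t → u t < 0 := fun t ht => by linarith [hle t ht]
  have hderiv : ∀ t, a ≤ t → HasDerivAt (fun s => (u s)⁻¹) (-deriv u t / u t ^ 2) t :=
    fun t ht => (hu t).hasDerivAt.fun_inv (hneg t ht).ne
  set c : ℝ := 1 - k ^ 2 / u a ^ 2 with hc
  have hua : 0 < u a ^ 2 := by nlinarith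
  have hcpos : 0 < c := by
    rw [hc, sub_pos, div_lt_one hua]
    nlinarith
  have hcle : ∀ t, a ≤ t → c ≤ -deriv u t / u t ^ 2 := by
    intro t ht
    have hsq : u a ^ 2 ≤ u t ^ 2 := by nlinarith [hle t ht]
    have hut : 0 < u t ^ 2 := hua.trans_le hsq
    calc c ≤ 1 - k ^ 2 / u t ^ 2 := by rw [hc]; gcongr
      _ = (u t ^ 2 - k ^ 2) / u t ^ 2 := by rw [sub_div, div_self hut.ne']
      _ ≤ -deriv u t / u t ^ 2 := by
        gcongr
        linarith [h t]
  have hb : a ≤ a + -(u a)⁻¹ / c := by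
    have : (u a)⁻¹ < 0 := inv_lt_zero.mpr (hneg a le_rfl)
    have : 0 < -(u a)⁻¹ / c := div_pos (by linarith) hcpos
    linarith
  have key := (convex_Ici a).mul_sub_le_image_sub_of_le_deriv (f := fun s => (u s)⁻¹) (C := c)
    (fun t ht => (hderiv t ht).continuousAt.continuousWithinAt)
    (fun t ht => (hderiv t (interior_subset ht)).differentiableAt.differentiableWithinAt)
    (fun t ht => by
      rw [(hderiv t (interior_subset ht)).deriv]
      exact hcle t (interior_subset ht))
    a self_mem_Ici _ hb hb
  rw [add_sub_cancel_left, mul_div_cancel₀ _ hcpos.ne'] at key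
  have := inv_lt_zero.mpr (hneg _ hb)
  linarith

theorem stmt_12 (K : ℝ → ℝ) (hK : Continuous K) (k : ℝ) (hk : 0 < k)
    (hKk : ∀ t : ℝ, -k ^ 2 < K t)
    (u : ℝ → ℝ) (hu : Differentiable ℝ u)
    (hric : ∀ t : ℝ, deriv u t + u t ^ 2 + K t = 0) :
    ∀ t : ℝ, |u t| ≤ k := by
  have hlt : ∀ t, deriv u t < k ^ 2 - u t ^ 2 := fun t => by linarith [hric t, hKk t]
  intro t
  refine abs_le.mpr ⟨neg_le_of_deriv_lt_sq_sub_sq hk hu hlt t, ?_⟩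
  have hrefl := neg_le_of_deriv_lt_sq_sub_sq hk (u := fun s => -u (-s))
    (hu.comp differentiable_neg).neg (fun s => ?_) (-t)
  · rw [neg_neg] at hrefl
    linarith
  · rw [deriv.fun_neg, deriv_comp_neg, neg_neg, neg_sq]
    exact hlt (-s)
end

section
/- Let K : ℝ → ℝ be continuous and let k > 0 satisfy K(t) > −k² for all t ∈ ℝ. If J : ℝ → ℝ is a solution of the Jacobi equation J''(t) + K(t)·J(t) = 0 with J(t) ≠ 0 for all t ∈ ℝ, then |J'(t)| ≤ k·|J(t)| for all t ∈ ℝ. -/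
open Set MeasureTheory Filter

/-- A positive function on the whole line with `f'' ≤ k² f` satisfies `f' ≤ k f`. -/
theorem deriv_le_mul_of_pos_of_second_deriv_le {f g h : ℝ → ℝ} {k : ℝ} (hk : 0 ≤ k)
    (hf : ∀ t, HasDerivAt f (g t) t) (hg : ∀ t, HasDerivAt g (h t) t)
    (hle : ∀ t, h t ≤ k ^ 2 * f t) (hpos : ∀ t, 0 < f t) (t : ℝ) : g t ≤ k * f t := by
  by_contra! hlt
  have hexp (c s : ℝ) : HasDerivAt (fun s => Real.exp (c * s)) (Real.exp (c * s) * c) s := by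
    simpa using ((hasDerivAt_id s).const_mul c).exp
  have hanti : Antitone fun s => Real.exp (k * s) * (g s - k * f s) := by
    refine antitone_of_hasDerivAt_nonpos
      (fun s => (hexp k s).mul ((hg s).sub ((hf s).const_mul k))) fun s => ?_
    have h₁ := mul_nonneg (Real.exp_pos (k * s)).le (sub_nonneg.2 (hle s))
    simp only [Pi.zero_apply]
    linarith
  set c := Real.exp (k * t) * (g t - k * f t)
  have hc_pos : 0 < c := mul_pos (Real.exp_pos _) (sub_pos.2 hlt)
  set d := Real.exp (-(2 * k) * t) * c
  have hd_pos : 0 < d := mul_pos (Real.exp_pos _) hc_pos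
  have hder (s : ℝ) := ((hexp (-k) s).mul (hf s)).sub ((hasDerivAt_id s).const_mul d)
  have hmono : MonotoneOn (fun s => Real.exp (-k * s) * f s - d * s) (Iic t) := by
    refine monotoneOn_of_hasDerivWithinAt_nonneg (convex_Iic t)
      (fun s _ => (hder s).continuousAt.continuousWithinAt)
      (fun s _ => (hder s).hasDerivWithinAt) fun s hs => ?_
    have hst : s ≤ t := mem_Iic.1 (interior_subset hs)
    have h₁ : d ≤ Real.exp (-(2 * k) * s) * (Real.exp (k * s) * (g s - k * f s)) :=
      mul_le_mul (Real.exp_le_exp.2 (by nlinarith)) (hanti hst) hc_pos.le (Real.exp_pos _).le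
    rw [← mul_assoc, ← Real.exp_add, show -(2 * k) * s + k * s = -k * s by ring] at h₁
    linarith
  set G := Real.exp (-k * t) * f t
  have hG_pos : 0 < G := mul_pos (Real.exp_pos _) (hpos t)
  have hst : t - G / d ≤ t := sub_le_self _ (div_pos hG_pos hd_pos).le
  have h₁ : Real.exp (-k * (t - G / d)) * f (t - G / d) - d * (t - G / d) ≤ G - d * t :=
    hmono (mem_Iic.2 hst) (mem_Iic.2 le_rfl) hst
  have h₂ : d * (t - G / d) = d * t - G := by field_simp
  have h₃ := mul_pos (Real.exp_pos (-k * (t - G / d))) (hpos (t - G / d))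
  linarith

/-- A positive function on the whole line with `f'' ≤ k² f` satisfies `|f'| ≤ k f`. -/
theorem abs_deriv_le_mul_of_pos_of_second_deriv_le {f g h : ℝ → ℝ} {k : ℝ} (hk : 0 ≤ k)
    (hf : ∀ t, HasDerivAt f (g t) t) (hg : ∀ t, HasDerivAt g (h t) t)
    (hle : ∀ t, h t ≤ k ^ 2 * f t) (hpos : ∀ t, 0 < f t) (t : ℝ) : |g t| ≤ k * f t := by
  refine abs_le'.2 ⟨deriv_le_mul_of_pos_of_second_deriv_le hk hf hg hle hpos t, ?_⟩
  have hneg {u v : ℝ → ℝ} (huv : ∀ t, HasDerivAt u (v t) t) (s : ℝ) :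
      HasDerivAt (fun s => u (-s)) (-v (-s)) s := by
    simpa [Function.comp_def] using (huv (-s)).comp s (hasDerivAt_neg s)
  have hneg' (s : ℝ) : HasDerivAt (fun s => -g (-s)) (h (-s)) s := by
    simpa using (hneg hg s).fun_neg
  simpa using deriv_le_mul_of_pos_of_second_deriv_le hk (hneg hf) hneg'
    (fun s => hle (-s)) (fun s => hpos (-s)) (-t)

theorem stmt_13 (K : ℝ → ℝ) (hK : Continuous K) (k : ℝ) (hk : 0 < k)
    (hKk : ∀ t : ℝ, -k ^ 2 < K t)
    (J : ℝ → ℝ) (hJ : IsJacobiSolution K J) (hne : ∀ t : ℝ, J t ≠ 0) :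
    ∀ t : ℝ, |deriv J t| ≤ k * |J t| := by
  obtain ⟨hC, hEq⟩ := hJ
  have hf (t : ℝ) : HasDerivAt J (deriv J t) t :=
    (hC.differentiable (by norm_num) t).hasDerivAt
  have hg (t : ℝ) : HasDerivAt (deriv J) (deriv (deriv J) t) t :=
    (hC.differentiable_deriv_two t).hasDerivAt
  have hsign : (∀ t, 0 < J t) ∨ ∀ t, J t < 0 := by
    by_contra! hcon
    obtain ⟨⟨a, ha⟩, b, hb⟩ := hcon
    obtain ⟨c, hc⟩ := mem_range_of_exists_le_of_exists_ge hC.continuous ⟨a, ha⟩ ⟨b, hb⟩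
    exact hne c hc
  intro t
  rcases hsign with hpos | hneg
  · rw [abs_of_pos (hpos t)]
    exact abs_deriv_le_mul_of_pos_of_second_deriv_le hk.le hf hg
      (fun s => by nlinarith [hEq s, hKk s, hpos s]) hpos t
  · rw [abs_of_neg (hneg t), ← abs_neg]
    exact abs_deriv_le_mul_of_pos_of_second_deriv_le hk.le (fun s => (hf s).neg)
      (fun s => (hg s).neg) (fun s => by simp only [Pi.neg_apply]; nlinarith [hEq s, hKk s, hneg s])
      (fun s => neg_pos.2 (hneg s)) t
end

section
/- Let K : ℝ → ℝ be continuous with K(t) ≥ 0 for all t ∈ ℝ. If u : ℝ → ℝ is differentiable and satisfies the Riccati equation u'(t) + u(t)² + K(t) = 0 for all t ∈ ℝ, then u(t) = 0 and K(t) = 0 for all t ∈ ℝ. -/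
open Set MeasureTheory Filter

/-- A global solution of the differential inequality `u' ≤ -u²` is nonnegative: a negative value
would force blow-up in finite forward time. -/
theorem nonneg_of_deriv_le_neg_sq {u : ℝ → ℝ} (hu : Differentiable ℝ u)
    (h : ∀ t, deriv u t ≤ -u t ^ 2) (a : ℝ) : 0 ≤ u a := by
  by_contra! ha
  have hanti : Antitone u :=
    antitone_of_deriv_nonpos hu fun t => (h t).trans (neg_nonpos.2 (sq_nonneg _))
  have hneg : ∀ t ∈ Ici a, u t < 0 := fun t ht => (hanti ht).trans_lt ha
  have hderiv : ∀ t ∈ Ici a,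
      HasDerivAt (fun s => (u s)⁻¹ - s) (-deriv u t / u t ^ 2 - 1) t := fun t ht =>
    ((hu t).hasDerivAt.fun_inv (hneg t ht).ne).sub (hasDerivAt_id t)
  have hmono : MonotoneOn (fun s => (u s)⁻¹ - s) (Ici a) := by
    refine monotoneOn_of_deriv_nonneg (convex_Ici a)
      (fun t ht => (hderiv t ht).continuousAt.continuousWithinAt)
      (fun t ht => (hderiv t (interior_subset ht)).differentiableAt.differentiableWithinAt)
      fun t ht => ?_
    have ht' := interior_subset ht
    rw [(hderiv t ht').deriv, sub_nonneg, one_le_div (sq_pos_of_neg (hneg t ht'))]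
    linarith [h t]
  have hab : a ≤ a - (u a)⁻¹ := by linarith [inv_lt_zero.2 ha]
  have hle := hmono self_mem_Ici hab hab
  have hb := inv_lt_zero.2 (hneg _ hab)
  simp only at hle
  linarith

theorem stmt_17 (K : ℝ → ℝ) (hK : Continuous K) (hKpos : ∀ t : ℝ, 0 ≤ K t)
    (u : ℝ → ℝ) (hu : Differentiable ℝ u)
    (hric : ∀ t : ℝ, deriv u t + u t ^ 2 + K t = 0) :
    ∀ t : ℝ, u t = 0 ∧ K t = 0 := by
  have hle : ∀ t, deriv u t ≤ -u t ^ 2 := fun t => by linarith [hric t, hKpos t]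
  have hrefl : ∀ t, HasDerivAt (fun s => -u (-s)) (deriv u (-t)) t := fun t => by
    simpa using ((hu (-t)).hasDerivAt.comp t (hasDerivAt_neg t)).fun_neg
  have hzero : ∀ t, u t = 0 := fun t => by
    have hneg := nonneg_of_deriv_le_neg_sq (fun s => (hrefl s).differentiableAt)
      (fun s => by simpa [(hrefl s).deriv] using hle (-s)) (-t)
    rw [neg_neg] at hneg
    exact le_antisymm (neg_nonneg.1 hneg) (nonneg_of_deriv_le_neg_sq hu hle t)
  have hu0 : u = fun _ => 0 := funext hzero
  intro t
  exact ⟨hzero t, by simpa [hu0] using hric t⟩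
end
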